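/- For an infinite Coxeter system (W,S), the poset W̄ under the weak order is a complete lattice if and only if W is isomorphic to a weak direct product of countably many irreducible Coxeter groups each of which is finite or locally finite. -/

import Mathlib

namespace CoxInf

variable {B : Type*} {W : Type*} [Group W] {M : CoxeterMatrix B}

/-- The inversion set `Φ_w` of `w⁻¹`, encoded via the canonical bijection between the
positive roots and the reflections: it corresponds to the set of left inversions of `w`. -/
def invSet (cs : CoxeterSystem M W) (w : W) : Set W :=
  {t | cs.IsLeftInversion w t}

/-- The length-`n` prefix of an infinite word in the generators. -/
def prefixWord (ω : ℕ → B) (n : ℕ) : List B := List.ofFn fun i : Fin n => ω i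

/-- `ω` is an infinite reduced expression: every finite prefix is reduced. -/
def IsInfRedExpr (cs : CoxeterSystem M W) (ω : ℕ → B) : Prop :=
  ∀ n, cs.IsReduced (prefixWord ω n)

/-- The elements of `W̄ = W ⊎ W_l`, represented as finite elements together with
infinite reduced expressions (an infinite reduced word is an equivalence class of
infinite reduced expressions having the same inversion set). -/
def barInv (cs : CoxeterSystem M W) : W ⊕ {ω : ℕ → B // IsInfRedExpr cs ω} → Set W
  | .inl w => invSet cs w
  | .inr ω => ⋃ n, invSet cs (cs.wordProd (prefixWord ω.1 n))

end CoxInf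
namespace CoxInf

/-- The weak direct product of a family of groups: the subgroup of the direct product
consisting of the elements with all but finitely many coordinates trivial. -/
def weakProduct (ι : Type*) (G : ι → Type*) [∀ i, Group (G i)] : Subgroup (∀ i, G i) where
  carrier := {f | {i | f i ≠ 1}.Finite}
  one_mem' := by simp
  mul_mem' := by
    intro f g hf hg
    refine (hf.union hg).subset ?_
    intro i hi
    simp only [Set.mem_setOf_eq, Set.mem_union]
    by_contra hc
    push_neg at hc
    exact hi (by simp [Pi.mul_apply, hc.1, hc.2])
  inv_mem' := by
    intro f hf
    simpa [Set.setOf_and, inv_eq_one] using hf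

/-- A Coxeter matrix is irreducible if its Coxeter diagram is connected and nonempty. -/
def CoxIrreducible {B : Type*} (M : CoxeterMatrix B) : Prop :=
  Nonempty B ∧ ∀ X : Set B, (∀ a ∈ X, ∀ b ∉ X, M a b = 2) → X = ∅ ∨ X = Set.univ

/-- A Coxeter matrix presents a locally finite Coxeter group if the group is infinite and
every standard parabolic subgroup generated by finitely many simple reflections is finite. -/
def IsLocallyFinite {B : Type*} (M : CoxeterMatrix B) : Prop :=
  Infinite M.Group ∧
    ∀ J : Set B, J.Finite → Finite (Subgroup.closure (M.simple '' J))

end CoxInf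

namespace CoxInf

section InversionCocycle

variable {B W : Type*} [Group W] {M : CoxeterMatrix B} (cs : CoxeterSystem M W)

theorem functionEnd_mul_apply {α : Type*} (f g : Function.End α) (x : α) :
    (f * g) x = f (g x) := rfl

theorem functionEnd_one_apply {α : Type*} (x : α) : (1 : Function.End α) x = x := rfl

open Classical in
/-- The action of a simple reflection on pairs (element, sign), which records the parity with
which an element occurs in an inversion sequence. -/
noncomputable def parityStep (i : B) : Function.End (W × ZMod 2) := fun p =>
  (cs.simple i * p.1 * cs.simple i, p.2 + if p.1 = cs.simple i then 1 else 0)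

theorem parityStep_mul_pow_apply (i j : B) (n : ℕ) (t : W) (e : ZMod 2) :
    ((parityStep cs i * parityStep cs j) ^ n) (t, e) =
      ((cs.simple i * cs.simple j) ^ n * t * ((cs.simple i * cs.simple j) ^ n)⁻¹,
        e + ∑ k ∈ Finset.range (2 * n),
          open Classical in
          if t = (cs.simple j * cs.simple i) ^ k * cs.simple j then 1 else 0) := by
  classical
  set a := cs.simple i with ha
  set b := cs.simple j with hb
  have haa : a * a = 1 := cs.simple_mul_simple_self i
  have hbb : b * b = 1 := cs.simple_mul_simple_self j
  have hai : a⁻¹ = a := cs.inv_simple i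
  have hbi : b⁻¹ = b := cs.inv_simple j
  induction n with
  | zero => simp [functionEnd_one_apply]
  | succ n ih =>
    rw [pow_succ', functionEnd_mul_apply, ih, functionEnd_mul_apply]
    have hinv : ((a * b) ^ n)⁻¹ = (b * a) ^ n := by
      rw [← inv_pow, mul_inv_rev, hai, hbi]
    have hcomm : b * (a * b) ^ n = (b * a) ^ n * b := by
      clear ih hinv
      induction n with
      | zero => simp
      | succ n ih => rw [pow_succ, ← mul_assoc, ih, pow_succ]; simp only [mul_assoc]
    have h1 : ((a * b) ^ n * t * ((a * b) ^ n)⁻¹ = b) ↔ t = (b * a) ^ (2 * n) * b := by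
      rw [mul_inv_eq_iff_eq_mul, ← eq_inv_mul_iff_mul_eq, hcomm, hinv, two_mul, pow_add, mul_assoc]
    have h2 : (b * ((a * b) ^ n * t * ((a * b) ^ n)⁻¹) * b = a) ↔
        t = (b * a) ^ (2 * n + 1) * b := by
      have : (b * ((a * b) ^ n * t * ((a * b) ^ n)⁻¹) * b = a) ↔
          ((a * b) ^ n * t * ((a * b) ^ n)⁻¹ = b * a * b) := by
        generalize (a * b) ^ n * t * ((a * b) ^ n)⁻¹ = x
        rw [← hbi, mul_inv_eq_iff_eq_mul, inv_mul_eq_iff_eq_mul, ← hbi, mul_assoc]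
        simp only [hbi]
      rw [this, mul_inv_eq_iff_eq_mul, ← eq_inv_mul_iff_mul_eq, mul_assoc (b * a), hcomm, hinv]
      rw [show 2 * n + 1 = n + (1 + n) by ring, pow_add, pow_add, pow_one]
      simp only [mul_assoc]
    rw [show 2 * (n + 1) = 2 * n + 1 + 1 by ring, Finset.sum_range_succ, Finset.sum_range_succ]
    simp only [parityStep, ← ha, ← hb, h1, h2]
    refine Prod.ext ?_ ?_
    · simp only [pow_succ', mul_inv_rev, hai, hbi, mul_assoc]
    · simp only [add_assoc]

theorem parityStep_isLiftable : M.IsLiftable (parityStep cs) := by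
  classical
  intro i j
  funext ⟨t, e⟩
  rw [parityStep_mul_pow_apply, two_mul, Finset.sum_range_add]
  have h (k : ℕ) : (cs.simple j * cs.simple i) ^ (M i j + k) = (cs.simple j * cs.simple i) ^ k := by
    rw [pow_add, cs.simple_mul_simple_pow', one_mul]
  simp only [h, cs.simple_mul_simple_pow, CharTwo.add_self_eq_zero]
  simp [functionEnd_one_apply]

/-- The homomorphism extending `parityStep`. -/
noncomputable def parityHom : W →* Function.End (W × ZMod 2) :=
  cs.lift ⟨parityStep cs, parityStep_isLiftable cs⟩

/-- The parity with which `t` occurs in the right inversion sequence of a word for `w`. -/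
noncomputable def parity (w t : W) : ZMod 2 := (parityHom cs w (t, 0)).2

open Classical in
theorem parityHom_wordProd (ω : List B) (t : W) (e : ZMod 2) :
    parityHom cs (cs.wordProd ω) (t, e) =
      (cs.wordProd ω * t * (cs.wordProd ω)⁻¹, e + ((cs.rightInvSeq ω).count t : ℕ)) := by
  induction ω with
  | nil => simp [functionEnd_one_apply]
  | cons i ω ih =>
    rw [cs.wordProd_cons, map_mul, functionEnd_mul_apply, ih]
    have h : parityHom cs (cs.simple i) = parityStep cs i := cs.lift_apply_simple _ i
    have h1 : (cs.wordProd ω * t * (cs.wordProd ω)⁻¹ = cs.simple i) ↔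
        ((cs.wordProd ω)⁻¹ * cs.simple i * cs.wordProd ω = t) := by
      rw [mul_inv_eq_iff_eq_mul, ← eq_inv_mul_iff_mul_eq, eq_comm, mul_assoc]
    rw [h, parityStep, CoxeterSystem.rightInvSeq, List.count_cons]
    refine Prod.ext ?_ ?_
    · simp [mul_assoc]
    · simp only [h1, add_assoc, beq_iff_eq]
      push_cast
      rfl

open Classical in
theorem parity_wordProd (ω : List B) (t : W) :
    parity cs (cs.wordProd ω) t = ((cs.rightInvSeq ω).count t : ℕ) := by
  simp [parity, parityHom_wordProd]

theorem parityHom_apply (w t : W) (e : ZMod 2) :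
    parityHom cs w (t, e) = (w * t * w⁻¹, e + parity cs w t) := by
  classical
  obtain ⟨ω, rfl⟩ := cs.wordProd_surjective w
  rw [parityHom_wordProd, parity_wordProd]

theorem parity_mul (x y t : W) :
    parity cs (x * y) t = parity cs y t + parity cs x (y * t * y⁻¹) := by
  conv_lhs => rw [parity, map_mul, functionEnd_mul_apply, parityHom_apply, parityHom_apply]
  simp

theorem parity_one (t : W) : parity cs 1 t = 0 := by
  simp [parity, functionEnd_one_apply]

theorem parity_self {t : W} (ht : cs.IsReflection t) : parity cs t t = 1 := by
  obtain ⟨w, i, rfl⟩ := ht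
  have h1 : parity cs (cs.simple i) (cs.simple i) = 1 := by
    have := parity_wordProd cs [i] (cs.simple i)
    simpa using this
  have h2 : parity cs w⁻¹ (w * cs.simple i * w⁻¹) + parity cs w (cs.simple i) = 0 := by
    have := parity_mul cs w w⁻¹ (w * cs.simple i * w⁻¹)
    simpa [parity_one, mul_assoc] using this.symm
  rw [parity_mul, parity_mul]
  simp only [mul_assoc, inv_mul_cancel_left, inv_inv, inv_mul_cancel, mul_one, one_mul,
    CoxeterSystem.inv_simple, CoxeterSystem.simple_mul_simple_self]
  simp only [mul_assoc] at h2
  rw [h1, add_left_comm, h2, add_zero]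

theorem isRightInversion_iff_parity {w t : W} (ht : cs.IsReflection t) :
    cs.IsRightInversion w t ↔ parity cs w t = 1 := by
  classical
  have key : ∀ w, parity cs w t = 1 → cs.IsRightInversion w t := by
    intro w hw
    obtain ⟨ω, hω, rfl⟩ := cs.exists_isReduced w
    rw [parity_wordProd] at hw
    refine cs.isRightInversion_of_mem_rightInvSeq hω ?_
    by_contra hmem
    rw [List.count_eq_zero_of_not_mem hmem] at hw
    simp at hw
  refine ⟨fun h => ?_, key w⟩
  by_contra hne
  have h0 : parity cs w t = 0 := by
    revert hne; generalize parity cs w t = z; revert z; decide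
  refine (ht.isRightInversion_mul_left_iff.1 (key (w * t) ?_)) h
  rw [parity_mul, parity_self cs ht, mul_inv_cancel_right, h0, add_zero]

/-- The cocycle property of left inversion sets. -/
theorem mem_invSet_mul {x y t : W} (ht : cs.IsReflection t) :
    t ∈ invSet cs (x * y) ↔ ¬(t ∈ invSet cs x ↔ x⁻¹ * t * x ∈ invSet cs y) := by
  have ht' : cs.IsReflection (x⁻¹ * t * x) := by simpa using ht.conj x⁻¹
  simp only [invSet, Set.mem_ofPred_eq, ← CoxeterSystem.isRightInversion_inv_iff]
  rw [isRightInversion_iff_parity cs ht, isRightInversion_iff_parity cs ht,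
    isRightInversion_iff_parity cs ht', mul_inv_rev, parity_mul, inv_inv]
  generalize parity cs x⁻¹ t = a
  generalize parity cs y⁻¹ (x⁻¹ * t * x) = b
  revert a b; decide

theorem invSet_one : invSet cs 1 = ∅ := by
  ext t; simp [invSet, CoxeterSystem.IsLeftInversion]

theorem mem_invSet_self {t : W} (ht : cs.IsReflection t) : t ∈ invSet cs t := by
  have h := (ht.isLeftInversion_mul_right_iff (w := 1)).2 (by simp [CoxeterSystem.IsLeftInversion])
  rw [mul_one] at h
  exact h

theorem mem_invSet_inv_mul {x y t : W} (ht : cs.IsReflection t) :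
    t ∈ invSet cs (x⁻¹ * y) ↔
      ¬(x * t * x⁻¹ ∈ invSet cs x ↔ x * t * x⁻¹ ∈ invSet cs y) := by
  have := mem_invSet_mul cs (x := x) (y := x⁻¹ * y) (ht.conj x)
  rw [mul_inv_cancel_left, show x⁻¹ * (x * t * x⁻¹) * x = t by group] at this
  tauto

theorem mem_invSet_inv {x t : W} (ht : cs.IsReflection t) :
    t ∈ invSet cs x⁻¹ ↔ x * t * x⁻¹ ∈ invSet cs x := by
  have := mem_invSet_inv_mul cs (x := x) (y := 1) ht
  simpa [invSet_one] using this

theorem simple_mem_invSet {w : W} {i : B} :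
    cs.simple i ∈ invSet cs w ↔ cs.length (cs.simple i * w) < cs.length w :=
  and_iff_right (cs.isReflection_simple i)

theorem exists_simple_mem_invSet {w : W} (hw : w ≠ 1) : ∃ i, cs.simple i ∈ invSet cs w := by
  obtain ⟨i, hi⟩ := cs.exists_leftDescent_of_ne_one hw
  exact ⟨i, (simple_mem_invSet cs).2 hi⟩

theorem mem_invSet_simple {i : B} {t : W} : t ∈ invSet cs (cs.simple i) ↔ t = cs.simple i := by
  refine ⟨fun h => ?_, ?_⟩
  swap
  · rintro rfl
    exact mem_invSet_self cs (cs.isReflection_simple i)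
  have h2 : cs.length (t * cs.simple i) < 1 := by simpa using h.2
  have h3 : t * cs.simple i = 1 := cs.length_eq_zero_iff.1 (by omega)
  rw [mul_eq_one_iff_eq_inv.1 h3, cs.inv_simple]

theorem mem_invSet_wordProd {ω : List B} (hω : cs.IsReduced ω) {t : W} :
    t ∈ invSet cs (cs.wordProd ω) ↔ t ∈ cs.leftInvSeq ω := by
  classical
  refine ⟨fun h => ?_, fun h => cs.isLeftInversion_of_mem_leftInvSeq hω h⟩
  have h' := h
  rw [invSet, Set.mem_ofPred_eq, ← CoxeterSystem.isRightInversion_inv_iff,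
    isRightInversion_iff_parity cs h.1, ← cs.wordProd_reverse, parity_wordProd,
    cs.rightInvSeq_reverse] at h'
  by_contra hmem
  rw [List.count_eq_zero_of_not_mem (by simpa using hmem)] at h'
  simp at h'

theorem invSet_finite (w : W) : (invSet cs w).Finite := by
  obtain ⟨ω, hω, rfl⟩ := cs.exists_isReduced w
  refine (List.finite_toSet (cs.leftInvSeq ω)).subset fun t ht => ?_
  exact (mem_invSet_wordProd cs hω).1 ht

theorem ncard_invSet (w : W) : (invSet cs w).ncard = cs.length w := by
  classical
  obtain ⟨ω, hω, rfl⟩ := cs.exists_isReduced w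
  have : invSet cs (cs.wordProd ω) = ((cs.leftInvSeq ω).toFinset : Set W) := by
    ext t; simp [mem_invSet_wordProd cs hω]
  rw [this, Set.ncard_coe_finset, List.toFinset_card_of_nodup hω.nodup_leftInvSeq, hω.eq,
    cs.length_leftInvSeq]

theorem length_add_length_inv_mul {x y : W} (h : invSet cs x ⊆ invSet cs y) :
    cs.length x + cs.length (x⁻¹ * y) = cs.length y := by
  have h1 : invSet cs (x⁻¹ * y) = MulAut.conj x⁻¹ '' (invSet cs y \ invSet cs x) := by
    ext t
    constructor
    · intro ht
      rw [mem_invSet_inv_mul cs ht.1] at ht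
      refine ⟨x * t * x⁻¹, ?_, by simp [mul_assoc]⟩
      have := @h (x * t * x⁻¹)
      simp only [Set.mem_sdiff]
      tauto
    · rintro ⟨u, ⟨hu, hu'⟩, rfl⟩
      have hr : cs.IsReflection (x⁻¹ * u * x) := by simpa using hu.1.conj x⁻¹
      simp only [MulAut.conj_apply, inv_inv]
      rw [mem_invSet_inv_mul cs hr, show x * (x⁻¹ * u * x) * x⁻¹ = u by group]
      tauto
  rw [← ncard_invSet, ← ncard_invSet, ← ncard_invSet, h1,
    Set.ncard_image_of_injective _ (MulAut.conj x⁻¹).injective, add_comm,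
    Set.ncard_sdiff_add_ncard_of_subset h (invSet_finite cs y)]

end InversionCocycle

end CoxInf

namespace CoxInf

section Parabolic

variable {B W : Type*} [Group W] {M : CoxeterMatrix B} (cs : CoxeterSystem M W)

/-- The standard parabolic subgroup generated by the simple reflections indexed by `J`. -/
def parabolic (J : Set B) : Subgroup W := Subgroup.closure (cs.simple '' J)

theorem simple_mem_parabolic {J : Set B} {i : B} (hi : i ∈ J) : cs.simple i ∈ parabolic cs J :=
  Subgroup.subset_closure ⟨i, hi, rfl⟩

theorem parabolic_mono {J K : Set B} (h : J ⊆ K) : parabolic cs J ≤ parabolic cs K :=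
  Subgroup.closure_mono (Set.image_mono h)

theorem parabolic_induction {J : Set B} {p : W → Prop} (one : p 1)
    (simple_mul : ∀ i ∈ J, ∀ u, p u → p (cs.simple i * u)) {u : W} (hu : u ∈ parabolic cs J) :
    p u := by
  refine Subgroup.closure_induction_left (p := fun x _ => p x) one ?_ ?_ hu
  · rintro _ ⟨i, hi, rfl⟩ y _ hy
    exact simple_mul i hi y hy
  · rintro _ ⟨i, hi, rfl⟩ y _ hy
    rw [cs.inv_simple]
    exact simple_mul i hi y hy

theorem invSet_subset_parabolic {J : Set B} {u : W} (hu : u ∈ parabolic cs J) :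
    invSet cs u ⊆ parabolic cs J := by
  refine parabolic_induction cs (p := fun u => invSet cs u ⊆ parabolic cs J) ?_ ?_ hu
  · simp [invSet_one]
  · intro i hi u ih t ht
    have hs := simple_mem_parabolic cs hi
    rw [mem_invSet_mul cs ht.1] at ht
    by_cases h1 : t ∈ invSet cs (cs.simple i)
    · rw [mem_invSet_simple] at h1
      exact h1 ▸ hs
    · have h2 := ih (show (cs.simple i)⁻¹ * t * cs.simple i ∈ invSet cs u by tauto)
      have := mul_mem (mul_mem hs h2) (inv_mem hs)
      simpa [mul_assoc] using this

/-- The inversions of `w` inside a parabolic subgroup form the inversion set of an element of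
this subgroup. -/
theorem exists_invSet_eq_inter (J : Set B) (w : W) :
    ∃ a ∈ parabolic cs J, invSet cs a = invSet cs w ∩ parabolic cs J := by
  obtain ⟨b, hb, hmin⟩ : ∃ b ∈ parabolic cs J, ∀ c ∈ parabolic cs J,
      cs.length (b * w) ≤ cs.length (c * w) := by
    let S : Set ℕ := {n | ∃ b ∈ parabolic cs J, cs.length (b * w) = n}
    have hS : S.Nonempty := ⟨_, 1, one_mem _, rfl⟩
    obtain ⟨b, hb, hbn⟩ := Nat.sInf_mem hS
    exact ⟨b, hb, fun c hc => hbn ▸ Nat.sInf_le ⟨c, hc, rfl⟩⟩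
  have key : ∀ t ∈ parabolic cs J, t ∉ invSet cs (b * w) := by
    rintro t ht ⟨_, hlt⟩
    have := hmin (t * b) (mul_mem ht hb)
    rw [mul_assoc] at this
    omega
  refine ⟨b⁻¹, inv_mem hb, ?_⟩
  have hmem : ∀ t ∈ parabolic cs J, cs.IsReflection t →
      (t ∈ invSet cs w ↔ t ∈ invSet cs b⁻¹) := by
    intro t ht hr
    have := mem_invSet_mul cs (x := b⁻¹) (y := b * w) hr
    rw [inv_mul_cancel_left] at this
    have h2 := key (b⁻¹⁻¹ * t * b⁻¹) (by
      rw [inv_inv]; exact mul_mem (mul_mem hb ht) (inv_mem hb))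
    tauto
  ext t
  constructor
  · intro ht
    have hP := invSet_subset_parabolic cs (inv_mem hb) ht
    exact ⟨(hmem t hP ht.1).2 ht, hP⟩
  · rintro ⟨ht, hP⟩
    exact (hmem t hP ht.1).1 ht

/-- `x` is obtained from `y` by one downward step in the Bruhat order. -/
def BruhatStep (x y : W) : Prop := ∃ t ∈ invSet cs y, x = t * y

theorem BruhatStep.simple_mul {x y : W} (h : BruhatStep cs x y) (i : B) :
    cs.simple i * x = y ∨ BruhatStep cs (cs.simple i * x) (cs.simple i * y) := by
  obtain ⟨t, ht, rfl⟩ := h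
  by_cases hti : t = cs.simple i
  · left
    rw [hti, cs.simple_mul_simple_cancel_left]
  · right
    have hr : cs.IsReflection (cs.simple i * t * cs.simple i) := by simpa using ht.1.conj (cs.simple i)
    refine ⟨cs.simple i * t * cs.simple i, ?_, by simp [mul_assoc]⟩
    rw [mem_invSet_mul cs hr, mem_invSet_simple]
    have h1 : (cs.simple i)⁻¹ * (cs.simple i * t * cs.simple i) * cs.simple i = t := by
      simp [mul_assoc]
    have h2 : cs.simple i * t * cs.simple i ≠ cs.simple i := by
      intro h
      apply hti
      have h3 : cs.simple i * t = 1 := by simpa using h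
      rw [← mul_one (cs.simple i), ← h3, cs.simple_mul_simple_cancel_left]
    rw [h1]
    tauto

theorem BruhatStep.length_lt {x y : W} (h : BruhatStep cs x y) : cs.length x < cs.length y := by
  obtain ⟨t, ht, rfl⟩ := h
  exact ht.2

open Relation in
theorem length_le_of_bruhat {x y : W} (h : ReflTransGen (BruhatStep cs) x y) :
    cs.length x ≤ cs.length y := by
  induction h with
  | refl => exact le_rfl
  | tail _ h ih => exact ih.trans (BruhatStep.length_lt cs h).le

open Relation in
/-- If `s` is a left descent of `w`, the Bruhat interval below `w` is stable under `s`. -/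
theorem bruhat_simple_mul_left {u w : W} {i : B} (hi : cs.simple i ∈ invSet cs w)
    (h : ReflTransGen (BruhatStep cs) u w) :
    ReflTransGen (BruhatStep cs) (cs.simple i * u) w := by
  induction h using ReflTransGen.head_induction_on with
  | refl => exact .single ⟨_, hi, rfl⟩
  | head h1 h2 ih =>
    rcases BruhatStep.simple_mul cs h1 i with h | h
    · rwa [h]
    · exact .head h ih

open Relation in
/-- If `s` is not a left descent of `w`, the Bruhat upper set of `w` is stable under `s`. -/
theorem bruhat_simple_mul_right {u w : W} {i : B} (hi : cs.simple i ∉ invSet cs w)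
    (h : ReflTransGen (BruhatStep cs) w u) :
    ReflTransGen (BruhatStep cs) w (cs.simple i * u) := by
  induction h with
  | refl =>
    refine .single ⟨cs.simple i, ?_, (cs.simple_mul_simple_cancel_left i).symm⟩
    exact (cs.isReflection_simple i).isLeftInversion_mul_right_iff.2 hi
  | tail h1 h2 ih =>
    rcases BruhatStep.simple_mul cs h2 i with h | h
    · rwa [← h, cs.simple_mul_simple_cancel_left]
    · exact ih.tail h

open Relation in
theorem bruhat_one (w : W) : ReflTransGen (BruhatStep cs) 1 w := by
  induction hn : cs.length w using Nat.strong_induction_on generalizing w with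
  | _ n ih =>
    by_cases hw : w = 1
    · rw [hw]
    · obtain ⟨i, hi⟩ := exists_simple_mem_invSet cs hw
      have hstep : BruhatStep cs (cs.simple i * w) w := ⟨_, hi, rfl⟩
      exact (ih _ (hn ▸ BruhatStep.length_lt cs hstep) _ rfl).tail hstep

open Relation in
theorem finite_bruhat_lower (w : W) : {u | ReflTransGen (BruhatStep cs) u w}.Finite := by
  induction hn : cs.length w using Nat.strong_induction_on generalizing w with
  | _ n ih =>
    have : {u | ReflTransGen (BruhatStep cs) u w} ⊆
        {w} ∪ ⋃ t ∈ invSet cs w, {u | ReflTransGen (BruhatStep cs) u (t * w)} := by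
      intro u hu
      rcases hu.cases_tail with h | ⟨v, hv, t, ht, rfl⟩
      · exact Or.inl h.symm
      · right
        simp only [Set.mem_iUnion]
        exact ⟨t, ht, hv⟩
    refine ((Set.finite_singleton w).union ((invSet_finite cs w).biUnion fun t ht => ?_)).subset this
    exact ih _ (hn ▸ ht.2) _ rfl

theorem bruhat_of_mem_parabolic {J : Set B} {w : W} (hJ : ∀ i ∈ J, cs.simple i ∈ invSet cs w)
    {u : W} (hu : u ∈ parabolic cs J) : Relation.ReflTransGen (BruhatStep cs) u w :=
  parabolic_induction cs (p := fun u => Relation.ReflTransGen (BruhatStep cs) u w)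
    (bruhat_one cs w) (fun _ hi _ h => bruhat_simple_mul_left cs (hJ _ hi) h) hu

/-- A parabolic subgroup all of whose generators are left descents of one element is finite. -/
theorem finite_parabolic_of_descents {J : Set B} {w : W}
    (hJ : ∀ i ∈ J, cs.simple i ∈ invSet cs w) : (parabolic cs J : Set W).Finite :=
  (finite_bruhat_lower cs w).subset fun _ hu => bruhat_of_mem_parabolic cs hJ hu

theorem eq_one_of_no_descents {J : Set B} {u : W} (hu : u ∈ parabolic cs J)
    (hJ : ∀ i ∈ J, cs.simple i ∉ invSet cs u) : u = 1 := by
  have : ∀ v ∈ parabolic cs J, Relation.ReflTransGen (BruhatStep cs) u (v * u) := by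
    intro v hv
    refine parabolic_induction cs (p := fun v => Relation.ReflTransGen (BruhatStep cs) u (v * u))
      ?_ ?_ hv
    · rw [one_mul]
    · intro i hi v h
      rw [mul_assoc]
      exact bruhat_simple_mul_right cs (hJ i hi) h
  have h := length_le_of_bruhat cs (this u⁻¹ (inv_mem hu))
  rw [inv_mul_cancel, cs.length_one] at h
  exact cs.length_eq_zero_iff.1 (by omega)

theorem exists_longest {J : Set B} (hJ : (parabolic cs J : Set W).Finite) :
    ∃ d ∈ parabolic cs J, ∀ t ∈ parabolic cs J, cs.IsReflection t → t ∈ invSet cs d := by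
  obtain ⟨d, hd, hmax⟩ := Set.exists_max_image _ cs.length hJ ⟨1, one_mem (parabolic cs J)⟩
  refine ⟨d, hd, fun t ht hr => ⟨hr, ?_⟩⟩
  exact lt_of_le_of_ne (hmax _ (mul_mem ht hd)) (hr.length_mul_right_ne d)

/-- If all generators of a parabolic subgroup are left descents of `w`, so are all its
reflections. -/
theorem mem_invSet_of_mem_parabolic {J : Set B} {w : W}
    (hJ : ∀ i ∈ J, cs.simple i ∈ invSet cs w) {t : W} (ht : t ∈ parabolic cs J)
    (hr : cs.IsReflection t) : t ∈ invSet cs w := by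
  obtain ⟨a, ha, haw⟩ := exists_invSet_eq_inter cs J w
  obtain ⟨d, hd, hdt⟩ := exists_longest cs (finite_parabolic_of_descents cs hJ)
  have haJ : ∀ i ∈ J, cs.simple i ∈ invSet cs a := fun i hi =>
    haw ▸ ⟨hJ i hi, simple_mem_parabolic cs hi⟩
  have hlen := length_le_of_bruhat cs (bruhat_of_mem_parabolic cs haJ hd)
  have hsub : invSet cs a ⊆ invSet cs d := fun r hr' =>
    hdt r (invSet_subset_parabolic cs ha hr') hr'.1
  have heq : invSet cs a = invSet cs d := by
    refine Set.eq_of_subset_of_ncard_le hsub ?_ (invSet_finite cs d)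
    rwa [ncard_invSet, ncard_invSet]
  have : t ∈ invSet cs a := heq ▸ hdt t ht hr
  rw [haw] at this
  exact this.1

/-- `j` is the least upper bound of `x` and `y` in the weak order. -/
def IsWeakJoin (x y j : W) : Prop :=
  invSet cs x ⊆ invSet cs j ∧ invSet cs y ⊆ invSet cs j ∧
    ∀ u, invSet cs x ⊆ invSet cs u → invSet cs y ⊆ invSet cs u → invSet cs j ⊆ invSet cs u

theorem mem_invSet_mul_simple {z : W} {i : B} (hi : z * cs.simple i * z⁻¹ ∉ invSet cs z) {t : W} :
    t ∈ invSet cs (z * cs.simple i) ↔ t ∈ invSet cs z ∨ t = z * cs.simple i * z⁻¹ := by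
  have key : cs.IsReflection t →
      (t ∈ invSet cs (z * cs.simple i) ↔ t ∈ invSet cs z ∨ t = z * cs.simple i * z⁻¹) := by
    intro hr
    rw [mem_invSet_mul cs hr, mem_invSet_simple]
    have : z⁻¹ * t * z = cs.simple i ↔ t = z * cs.simple i * z⁻¹ := by
      rw [eq_mul_inv_iff_mul_eq, mul_assoc, inv_mul_eq_iff_eq_mul]
    rw [this]
    by_cases h : t = z * cs.simple i * z⁻¹
    · subst h; tauto
    · tauto
  constructor
  · exact fun h => (key h.1).1 h
  · intro h
    refine (key ?_).2 h
    rcases h with h | h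
    · exact h.1
    · exact h ▸ (cs.isReflection_simple i).conj z

/-- Two upper covers of `z` with a common upper bound have a join. -/
theorem exists_isWeakJoin_covers {z m : W} {i j : B}
    (hi : z * cs.simple i * z⁻¹ ∉ invSet cs z) (hj : z * cs.simple j * z⁻¹ ∉ invSet cs z)
    (him : invSet cs (z * cs.simple i) ⊆ invSet cs m)
    (hjm : invSet cs (z * cs.simple j) ⊆ invSet cs m) :
    ∃ d, IsWeakJoin cs (z * cs.simple i) (z * cs.simple j) d := by
  set J : Set B := {i, j} with hJdef
  have hJz : ∀ k ∈ J, z * cs.simple k * z⁻¹ ∉ invSet cs z := by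
    rintro k (rfl | rfl) <;> assumption
  -- generators are descents of `z⁻¹ * u` for every common upper bound `u`
  have hdesc : ∀ u, invSet cs (z * cs.simple i) ⊆ invSet cs u →
      invSet cs (z * cs.simple j) ⊆ invSet cs u →
      ∀ k ∈ J, cs.simple k ∈ invSet cs (z⁻¹ * u) := by
    rintro u hiu hju k hk
    rw [mem_invSet_inv_mul cs (cs.isReflection_simple k)]
    have h1 := hJz k hk
    have h2 : z * cs.simple k * z⁻¹ ∈ invSet cs u := by
      rcases hk with rfl | rfl
      · exact hiu ((mem_invSet_mul_simple cs hi).2 (Or.inr rfl))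
      · exact hju ((mem_invSet_mul_simple cs hj).2 (Or.inr rfl))
    tauto
  obtain ⟨d, hd, hdt⟩ := exists_longest cs (finite_parabolic_of_descents cs (hdesc m him hjm))
  -- reflections of the parabolic subgroup are not inversions of `z⁻¹`
  have hz : ∀ t ∈ parabolic cs J, t ∉ invSet cs z⁻¹ := by
    obtain ⟨b, hb, hbz⟩ := exists_invSet_eq_inter cs J z⁻¹
    have hb1 : b = 1 := by
      refine eq_one_of_no_descents cs hb fun k hk hmem => ?_
      rw [hbz] at hmem
      exact hJz k hk ((mem_invSet_inv cs (cs.isReflection_simple k)).1 hmem.1)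
    intro t ht hmem
    have : t ∈ invSet cs b := hbz ▸ ⟨hmem, ht⟩
    simp [hb1, invSet_one] at this
  have hmem : ∀ t, t ∈ invSet cs (z * d) ↔ t ∈ invSet cs z ∨ z⁻¹ * t * z ∈ invSet cs d := by
    have key : ∀ t, cs.IsReflection t →
        (t ∈ invSet cs (z * d) ↔ t ∈ invSet cs z ∨ z⁻¹ * t * z ∈ invSet cs d) := by
      intro t hr
      rw [mem_invSet_mul cs hr]
      have h1 : z⁻¹ * t * z ∈ invSet cs d → t ∉ invSet cs z := by
        intro h1 h2
        refine hz _ (invSet_subset_parabolic cs hd h1) ?_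
        rw [mem_invSet_inv cs h1.1]
        rwa [show z * (z⁻¹ * t * z) * z⁻¹ = t by group]
      tauto
    intro t
    refine ⟨fun h => (key t h.1).1 h, fun h => (key t ?_).2 h⟩
    rcases h with h | h
    · exact h.1
    · simpa [mul_assoc] using h.1.conj z
  have hcov : ∀ k ∈ J, invSet cs (z * cs.simple k) ⊆ invSet cs (z * d) := by
    intro k hk t ht
    rw [hmem]
    rcases (mem_invSet_mul_simple cs (hJz k hk)).1 ht with h | h
    · exact Or.inl h
    · right
      rw [h, show z⁻¹ * (z * cs.simple k * z⁻¹) * z = cs.simple k by group]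
      exact hdt _ (simple_mem_parabolic cs hk) (cs.isReflection_simple k)
  refine ⟨z * d, hcov i (by simp [hJdef]), hcov j (by simp [hJdef]), fun u hiu hju t ht => ?_⟩
  rcases (hmem t).1 ht with h | h
  · exact hiu ((mem_invSet_mul_simple cs hi).2 (Or.inl h))
  · have h1 := mem_invSet_of_mem_parabolic cs (hdesc u hiu hju) (invSet_subset_parabolic cs hd h) h.1
    rw [mem_invSet_inv_mul cs h.1, show z * (z⁻¹ * t * z) * z⁻¹ = t by group] at h1
    by_contra htu
    have htz : t ∈ invSet cs z := by tauto
    exact htu (hiu ((mem_invSet_mul_simple cs hi).2 (Or.inl htz)))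

theorem exists_cover {z x : W} (h : invSet cs z ⊆ invSet cs x) (hne : z ≠ x) :
    ∃ i, z * cs.simple i * z⁻¹ ∉ invSet cs z ∧ invSet cs (z * cs.simple i) ⊆ invSet cs x := by
  obtain ⟨i, hi⟩ := exists_simple_mem_invSet cs (w := z⁻¹ * x) (fun h => hne (inv_mul_eq_one.1 h))
  rw [mem_invSet_inv_mul cs (cs.isReflection_simple i)] at hi
  have h1 := @h (z * cs.simple i * z⁻¹)
  have h2 : z * cs.simple i * z⁻¹ ∉ invSet cs z := by tauto
  refine ⟨i, h2, fun t ht => ?_⟩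
  rcases (mem_invSet_mul_simple cs h2).1 ht with h3 | rfl
  · exact h h3
  · tauto

/-- Elements with a common upper bound in the weak order have a join. -/
theorem exists_isWeakJoin {x y m : W} (hx : invSet cs x ⊆ invSet cs m)
    (hy : invSet cs y ⊆ invSet cs m) : ∃ j, IsWeakJoin cs x y j := by
  suffices H : ∀ n, ∀ z x y : W, cs.length (z⁻¹ * m) = n → invSet cs z ⊆ invSet cs x →
      invSet cs z ⊆ invSet cs y → invSet cs x ⊆ invSet cs m → invSet cs y ⊆ invSet cs m →
      ∃ j, IsWeakJoin cs x y j from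
    H _ 1 x y rfl (by simp [invSet_one]) (by simp [invSet_one]) hx hy
  clear hx hy x y
  intro n
  induction n using Nat.strong_induction_on with
  | _ n ih =>
    intro z x y hn hzx hzy hx hy
    by_cases hzx' : z = x
    · exact ⟨y, hzx' ▸ hzy, subset_rfl, fun u _ h => h⟩
    by_cases hzy' : z = y
    · exact ⟨x, subset_rfl, hzy' ▸ hzx, fun u h _ => h⟩
    obtain ⟨i, hi, hix⟩ := exists_cover cs hzx hzx'
    obtain ⟨j, hj, hjy⟩ := exists_cover cs hzy hzy'
    have hlt : ∀ k, z * cs.simple k * z⁻¹ ∉ invSet cs z →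
        invSet cs (z * cs.simple k) ⊆ invSet cs m →
        cs.length ((z * cs.simple k)⁻¹ * m) < n := by
      intro k hk hkm
      rw [mul_inv_rev, cs.inv_simple, mul_assoc, ← hn, ← simple_mem_invSet,
        mem_invSet_inv_mul cs (cs.isReflection_simple k)]
      have := hkm ((mem_invSet_mul_simple cs hk).2 (Or.inr rfl))
      tauto
    obtain ⟨d, hid, hjd, hd⟩ := exists_isWeakJoin_covers cs hi hj (hix.trans hx) (hjy.trans hy)
    have hdm := hd m (hix.trans hx) (hjy.trans hy)
    have hzi : invSet cs z ⊆ invSet cs (z * cs.simple i) := fun t ht =>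
      (mem_invSet_mul_simple cs hi).2 (Or.inl ht)
    obtain ⟨p, hxp, hdp, hp⟩ := ih _ (hlt i hi (hix.trans hx)) _ x d rfl hix hid hx hdm
    obtain ⟨q, hyq, hdq, hq⟩ := ih _ (hlt j hj (hjy.trans hy)) _ y d rfl hjy hjd hy hdm
    obtain ⟨r, hpr, hqr, hr⟩ := ih _ (hlt i hi (hix.trans hx)) _ p q rfl (hid.trans hdp)
      (hid.trans hdq) (hp m hx hdm) (hq m hy hdm)
    refine ⟨r, hxp.trans hpr, hyq.trans hqr, fun u hxu hyu => ?_⟩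
    have hdu := hd u (hix.trans hxu) (hjy.trans hyu)
    exact hr u (hp u hxu hdu) (hq u hyu hdu)

theorem exists_weakJoin_finset (F : Finset W) {m : W} (hm : ∀ x ∈ F, invSet cs x ⊆ invSet cs m) :
    ∃ j, (∀ x ∈ F, invSet cs x ⊆ invSet cs j) ∧
      ∀ u, (∀ x ∈ F, invSet cs x ⊆ invSet cs u) → invSet cs j ⊆ invSet cs u := by
  classical
  induction F using Finset.induction_on with
  | empty => exact ⟨1, by simp, by simp [invSet_one]⟩
  | insert a F _ ih =>
    simp only [Finset.forall_mem_insert] at hm ⊢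
    obtain ⟨j, hj, hju⟩ := ih hm.2
    obtain ⟨k, hak, hjk, hk⟩ := exists_isWeakJoin cs hm.1 (hju m hm.2)
    exact ⟨k, ⟨hak, fun x hx => (hj x hx).trans hjk⟩, fun u hu => hk u hu.1 (hju u hu.2)⟩

end Parabolic

end CoxInf

namespace CoxInf

section Lattice

variable {B W : Type*} [Group W] {M : CoxeterMatrix B} (cs : CoxeterSystem M W)

theorem invSet_wordProd_take {ω : List B} (hω : cs.IsReduced ω) (n : ℕ) :
    invSet cs (cs.wordProd (ω.take n)) ⊆ invSet cs (cs.wordProd ω) := by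
  intro t ht
  rw [mem_invSet_wordProd cs (hω.take n), cs.leftInvSeq_take] at ht
  exact (mem_invSet_wordProd cs hω).2 (List.mem_of_mem_take ht)

theorem prefixWord_take (ω : ℕ → B) {m n : ℕ} (h : m ≤ n) :
    (prefixWord ω n).take m = prefixWord ω m := by
  refine List.ext_getElem (by simp [prefixWord, h]) fun i h1 h2 => ?_
  simp [prefixWord]

theorem monotone_invSet_prefixWord {ω : ℕ → B} (hω : IsInfRedExpr cs ω) :
    Monotone fun n => invSet cs (cs.wordProd (prefixWord ω n)) := by
  intro m n h
  change invSet cs (cs.wordProd (prefixWord ω m)) ⊆ invSet cs (cs.wordProd (prefixWord ω n))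
  rw [← prefixWord_take ω h]
  exact invSet_wordProd_take cs (hω n) m

theorem exists_subset_of_finite_of_subset_iUnion {α : Type*} {s : Set α} (hs : s.Finite)
    {f : ℕ → Set α} (hf : Monotone f) (h : s ⊆ ⋃ n, f n) : ∃ n, s ⊆ f n := by
  have h' : ∀ x, ∃ n, x ∈ s → x ∈ f n := fun x => by
    by_cases hx : x ∈ s
    · obtain ⟨n, hn⟩ := Set.mem_iUnion.1 (h hx)
      exact ⟨n, fun _ => hn⟩
    · exact ⟨0, fun h => absurd h hx⟩
  choose g hg using h'
  obtain ⟨n, hn⟩ := (hs.image g).bddAbove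
  exact ⟨n, fun x hx => hf (hn ⟨x, hx, rfl⟩) (hg x hx)⟩

/-- Finitely many elements of an extended inversion set lie in a finite inversion set below it. -/
theorem exists_invSet_between (x : W ⊕ {ω : ℕ → B // IsInfRedExpr cs ω}) {F : Set W}
    (hF : F.Finite) (h : F ⊆ barInv cs x) : ∃ w, F ⊆ invSet cs w ∧ invSet cs w ⊆ barInv cs x := by
  rcases x with w | ω
  · exact ⟨w, h, subset_rfl⟩
  · obtain ⟨n, hn⟩ := exists_subset_of_finite_of_subset_iUnion hF
      (monotone_invSet_prefixWord cs ω.2) h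
    exact ⟨_, hn, Set.subset_iUnion (fun n => invSet cs (cs.wordProd (prefixWord ω.1 n))) n⟩

theorem barInv_countable (x : W ⊕ {ω : ℕ → B // IsInfRedExpr cs ω}) :
    (barInv cs x).Countable := by
  rcases x with w | ω
  · exact (invSet_finite cs w).countable
  · exact Set.countable_iUnion fun n => (invSet_finite cs _).countable

theorem exists_invSet_eq_barInv_inter (x : W ⊕ {ω : ℕ → B // IsInfRedExpr cs ω}) {J : Set B}
    (hJ : (parabolic cs J : Set W).Finite) :
    ∃ a ∈ parabolic cs J, invSet cs a = barInv cs x ∩ parabolic cs J := by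
  obtain ⟨w, hw, hwx⟩ := exists_invSet_between cs x (F := barInv cs x ∩ parabolic cs J)
    (hJ.subset Set.inter_subset_right) Set.inter_subset_left
  obtain ⟨a, ha, haw⟩ := exists_invSet_eq_inter cs J w
  refine ⟨a, ha, haw.trans (Set.Subset.antisymm ?_ ?_)⟩
  · exact Set.inter_subset_inter_left _ hwx
  · exact fun t ht => ⟨hw ht, ht.2⟩

/-- The union of an increasing sequence of inversion sets is an extended inversion set. -/
theorem exists_barInv_eq_iUnion (v : ℕ → W) (hv : ∀ n, invSet cs (v n) ⊆ invSet cs (v (n + 1))) :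
    ∃ x, barInv cs x = ⋃ n, invSet cs (v n) := by
  have hmono : Monotone fun n => invSet cs (v n) := monotone_nat_of_le_succ hv
  choose r hr hrw using cs.exists_isReduced
  let L : ℕ → List B := fun n => n.rec (r (v 0)) fun n l => l ++ r ((v n)⁻¹ * v (n + 1))
  have hL : ∀ n, L (n + 1) = L n ++ r ((v n)⁻¹ * v (n + 1)) := fun n => rfl
  have hprod : ∀ n, cs.wordProd (L n) = v n := by
    intro n
    induction n with
    | zero => exact (hrw (v 0)).symm
    | succ n ih => rw [hL, cs.wordProd_append, ih, ← hrw, mul_inv_cancel_left]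
  have hred : ∀ n, cs.IsReduced (L n) := by
    intro n
    induction n with
    | zero => exact hr (v 0)
    | succ n ih =>
      have h1 := length_add_length_inv_mul cs (hv n)
      have h2 := (hr ((v n)⁻¹ * v (n + 1))).eq
      rw [← hrw] at h2
      have h3 := ih.eq
      rw [hprod] at h3
      refine (congrArg cs.length (hprod (n + 1))).trans ?_
      rw [hL, List.length_append, ← h1, h2, h3]
  have hpre : ∀ m n, m ≤ n → L m <+: L n := by
    intro m n hmn
    induction n, hmn using Nat.le_induction with
    | base => exact List.prefix_refl _
    | succ n _ ih => exact ih.trans (hL n ▸ List.prefix_append _ _)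
  have hlen : ∀ n, (L n).length = cs.length (v n) := fun n => by rw [← hprod n, (hred n).eq]
  by_cases hb : ∃ k, ∀ n, cs.length (v n) ≤ k
  · obtain ⟨k, hk⟩ := hb
    obtain ⟨n, hn⟩ := Nat.sSup_mem (s := Set.range fun n => cs.length (v n)) ⟨_, 0, rfl⟩
      ⟨k, by rintro _ ⟨n, rfl⟩; exact hk n⟩
    have hmax : ∀ m, cs.length (v m) ≤ cs.length (v n) := fun m => by
      simp only at hn
      rw [hn]
      exact le_csSup ⟨k, by rintro _ ⟨n, rfl⟩; exact hk n⟩ ⟨m, rfl⟩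
    refine ⟨.inl (v n), Set.Subset.antisymm (Set.subset_iUnion (fun n => invSet cs (v n)) n) ?_⟩
    refine Set.iUnion_subset fun m => ?_
    rcases le_total m n with h | h
    · exact hmono h
    · refine (Set.eq_of_subset_of_ncard_le (hmono h) ?_ (invSet_finite cs _)).superset
      rw [ncard_invSet, ncard_invSet]
      exact hmax m
  · push Not at hb
    choose N hN using hb
    simp only [← hlen] at hN
    let ω : ℕ → B := fun k => (L (N k))[k]'(hN k)
    have hω : ∀ n k, k ≤ (L n).length → prefixWord ω k = (L n).take k := by
      intro n k hk
      refine List.ext_getElem (by simp [prefixWord, hk]) fun i h1 h2 => ?_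
      have hi : i < (L n).length := by
        simp only [List.length_take] at h2; omega
      simp only [prefixWord, List.getElem_ofFn, List.getElem_take, ω]
      rcases le_total n (N i) with h | h
      · exact ((hpre _ _ h).getElem hi).symm
      · exact (hpre _ _ h).getElem (hN i)
    have hωred : IsInfRedExpr cs ω := fun k => by
      rw [hω (N k) k (hN k).le]
      exact (hred _).take k
    refine ⟨.inr ⟨ω, hωred⟩, Set.Subset.antisymm ?_ ?_⟩
    · refine Set.iUnion_subset fun k => ?_
      rw [hω (N k) k (hN k).le]
      refine (invSet_wordProd_take cs (hred _) k).trans ?_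
      rw [hprod]
      exact Set.subset_iUnion (fun n => invSet cs (v n)) (N k)
    · refine Set.iUnion_subset fun n => ?_
      have h := hω n (L n).length le_rfl
      rw [List.take_length] at h
      rw [← hprod n, ← h]
      exact Set.subset_iUnion (fun n => invSet cs (cs.wordProd (prefixWord ω n))) _

/-- If `W` is countable and its finitely generated standard parabolic subgroups are finite, then
every family in `W̄` has a join. -/
theorem exists_bar_join [Countable W]
    (hfin : ∀ J : Set B, (cs.simple '' J).Finite → (parabolic cs J : Set W).Finite)
    (A : Set (W ⊕ {ω : ℕ → B // IsInfRedExpr cs ω})) :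
    ∃ v, (∀ a ∈ A, barInv cs a ⊆ barInv cs v) ∧
      ∀ u, (∀ a ∈ A, barInv cs a ⊆ barInv cs u) → barInv cs v ⊆ barInv cs u := by
  obtain ⟨g, hg⟩ := exists_surjective_nat W
  let J : ℕ → Set B := fun n => {b | ∃ k ≤ n, g k = cs.simple b}
  have hJmono : Monotone J := fun m n h b ⟨k, hk, hb⟩ => ⟨k, hk.trans h, hb⟩
  have hP : ∀ n, (parabolic cs (J n) : Set W).Finite := by
    refine fun n => hfin _ (((Set.finite_Iic n).image g).subset ?_)
    rintro _ ⟨b, ⟨k, hk, hb⟩, rfl⟩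
    exact ⟨k, hk, hb⟩
  have hcover : ∀ w, ∃ n, w ∈ parabolic cs (J n) := by
    intro w
    induction w using cs.simple_induction_left with
    | one => exact ⟨0, one_mem _⟩
    | mul_simple_left w b ih =>
      obtain ⟨n, hn⟩ := ih
      obtain ⟨k, hk⟩ := hg (cs.simple b)
      exact ⟨max n k, mul_mem (simple_mem_parabolic cs ⟨k, le_max_right _ _, hk⟩)
        (parabolic_mono cs (hJmono (le_max_left n k)) hn)⟩
  let S : ℕ → Set W := fun n =>
    {a | a ∈ parabolic cs (J n) ∧ ∃ x ∈ A, invSet cs a = barInv cs x ∩ parabolic cs (J n)}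
  have hS : ∀ n, (S n).Finite := fun n => (hP n).subset fun a ha => ha.1
  have hjoin : ∀ n, ∃ j, (∀ x ∈ S n, invSet cs x ⊆ invSet cs j) ∧
      ∀ u, (∀ x ∈ S n, invSet cs x ⊆ invSet cs u) → invSet cs j ⊆ invSet cs u := by
    intro n
    obtain ⟨d, hd, hdt⟩ := exists_longest cs (hP n)
    have := exists_weakJoin_finset cs (hS n).toFinset (m := d) fun x hx t ht => by
      have hx' : x ∈ S n := by simpa using hx
      exact hdt t (invSet_subset_parabolic cs hx'.1 ht) ht.1
    simpa using this
  choose v hv hvmin using hjoin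
  have hmono : ∀ n, invSet cs (v n) ⊆ invSet cs (v (n + 1)) := by
    intro n
    refine hvmin n _ ?_
    rintro a ⟨ha, x, hx, hax⟩
    obtain ⟨a', ha', hax'⟩ := exists_invSet_eq_barInv_inter cs x (hP (n + 1))
    refine subset_trans ?_ (hv (n + 1) a' ⟨ha', x, hx, hax'⟩)
    rw [hax, hax']
    exact Set.inter_subset_inter_right _ (parabolic_mono cs (hJmono n.le_succ))
  obtain ⟨X, hX⟩ := exists_barInv_eq_iUnion cs v hmono
  refine ⟨X, fun x hx t ht => ?_, fun u hu => ?_⟩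
  · obtain ⟨n, hn⟩ := hcover t
    obtain ⟨a, ha, hax⟩ := exists_invSet_eq_barInv_inter cs x (hP n)
    rw [hX]
    exact Set.mem_iUnion.2 ⟨n, hv n a ⟨ha, x, hx, hax⟩ (hax ▸ ⟨ht, hn⟩)⟩
  · rw [hX]
    refine Set.iUnion_subset fun n => ?_
    obtain ⟨b, hb, hbu⟩ := exists_invSet_eq_barInv_inter cs u (hP n)
    have h1 : invSet cs (v n) ⊆ invSet cs b := by
      refine hvmin n b ?_
      rintro a ⟨ha, x, hx, hax⟩
      rw [hax, hbu]
      exact Set.inter_subset_inter_left _ (hu x hx)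
    exact h1.trans (hbu ▸ Set.inter_subset_left)

/-- If `W̄` has a greatest element, then `W` is countable. -/
theorem countable_of_bar_top {v : W ⊕ {ω : ℕ → B // IsInfRedExpr cs ω}}
    (hv : ∀ a, barInv cs a ⊆ barInv cs v) : Countable W := by
  have hs : (Set.range cs.simple).Countable := by
    refine (barInv_countable cs v).mono ?_
    rintro _ ⟨i, rfl⟩
    exact hv (.inl (cs.simple i)) (mem_invSet_self cs (cs.isReflection_simple i))
  have := hs.to_subtype
  refine Function.Surjective.countable (α := List (Set.range cs.simple))
    (f := fun l => (l.map Subtype.val).prod) fun w => ?_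
  obtain ⟨ω, rfl⟩ := cs.wordProd_surjective w
  exact ⟨ω.map fun i => ⟨cs.simple i, i, rfl⟩, by simp [CoxeterSystem.wordProd, Function.comp_def]⟩

/-- If `W̄` has a greatest element, then all finitely generated standard parabolic subgroups are
finite. -/
theorem finite_parabolic_of_bar_top {v : W ⊕ {ω : ℕ → B // IsInfRedExpr cs ω}}
    (hv : ∀ a, barInv cs a ⊆ barInv cs v) {J : Set B} (hJ : (cs.simple '' J).Finite) :
    (parabolic cs J : Set W).Finite := by
  obtain ⟨w, hw, _⟩ := exists_invSet_between cs v hJ (by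
    rintro _ ⟨i, _, rfl⟩
    exact hv (.inl (cs.simple i)) (mem_invSet_self cs (cs.isReflection_simple i)))
  exact finite_parabolic_of_descents cs fun i hi => hw ⟨i, hi, rfl⟩

end Lattice

end CoxInf

namespace CoxInf

/-! ### The geometric representation -/

section Geometric

open Module

variable {B : Type*} {W : Type*} [Group W] {M : CoxeterMatrix B}

/-- Minus the entries of the (possibly infinite) Cartan matrix attached to `M`. -/
noncomputable def cartan (M : CoxeterMatrix B) (i j : B) : ℝ := 2 * Real.cos (Real.pi / M i j)

/-- The simple coroots of the geometric representation. -/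
noncomputable def coroot (M : CoxeterMatrix B) (i : B) : Dual ℝ (B →₀ ℝ) :=
  Finsupp.linearCombination ℝ fun j => -cartan M i j

theorem cartan_symm (M : CoxeterMatrix B) (i j : B) : cartan M i j = cartan M j i := by
  rw [cartan, cartan, M.symmetric]

theorem cartan_self (M : CoxeterMatrix B) (i : B) : cartan M i i = -2 := by
  simp [cartan]

theorem cartan_eq_zero {i j : B} (h : M i j = 2) : cartan M i j = 0 := by
  simp [cartan, h]

theorem one_le_cartan {i j : B} (hij : i ≠ j) (h : M i j ≠ 2) : 1 ≤ cartan M i j := by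
  have h1 := M.off_diagonal i j hij
  rcases Nat.eq_zero_or_pos (M i j) with h0 | h0
  · simp [cartan, h0]
  · have h3 : (3 : ℝ) ≤ M i j := by exact_mod_cast (by omega : 3 ≤ M i j)
    have := Real.cos_le_cos_of_nonneg_of_le_pi (x := Real.pi / M i j) (y := Real.pi / 3)
      (by positivity) (by linarith [Real.pi_pos])
      (div_le_div_of_nonneg_left Real.pi_pos.le (by norm_num) h3)
    rw [Real.cos_pi_div_three] at this
    rw [cartan]
    linarith

@[simp]
theorem coroot_single (i j : B) (c : ℝ) : coroot M i (Finsupp.single j c) = -(c * cartan M i j) := by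
  simp [coroot]

theorem coroot_self (M : CoxeterMatrix B) (i : B) : coroot M i (Finsupp.single i 1) = 2 := by
  rw [coroot_single, cartan_self]
  norm_num

/-- The simple reflections of the geometric representation satisfy the Coxeter relations. -/
theorem isLiftable_reflection (M : CoxeterMatrix B) :
    M.IsLiftable fun i => reflection (coroot_self M i) := by
  intro i j
  rcases Nat.lt_or_ge (M i j) 2 with h | h
  · obtain h | h : M i j = 0 ∨ M i j = 1 := by omega
    · rw [h, pow_zero]
    · obtain rfl : i = j := by
        by_contra hij
        exact M.off_diagonal i j hij h
      rw [h, pow_one]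
      ext1 v
      exact involutive_reflection (coroot_self M i) v
  ext1 z
  rw [LinearEquiv.coe_one, id, reflection_mul_reflection_pow_apply]
  rw [coroot_single, coroot_single, cartan_symm M j i]
  rcases h.eq_or_lt with h | h
  · simp only [← h, cartan_eq_zero h.symm]
    norm_num
    module
  set m := M i j with hm
  have hm0 : (0 : ℝ) < m := by exact_mod_cast (by omega : 0 < m)
  have h3 : (3 : ℝ) ≤ m := by exact_mod_cast h
  set θ : ℝ := 2 * Real.pi / m with hθ
  have hmθ : m * θ = 2 * Real.pi := by rw [hθ]; field_simp
  have ht : -(1 * cartan M i j) * -(1 * cartan M i j) - 2 = 2 * Real.cos θ := by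
    rw [cartan, hθ, mul_div_assoc, Real.cos_two_mul]
    ring
  have hsin : Real.sin θ ≠ 0 := by
    refine (Real.sin_pos_of_pos_of_lt_pi (by positivity) ?_).ne'
    rw [hθ, div_lt_iff₀ hm0]
    nlinarith [Real.pi_pos]
  rw [ht]
  have hS : ∀ n : ℤ, (Polynomial.Chebyshev.S ℝ n).eval (2 * Real.cos θ) =
      Real.sin ((n + 1) * θ) / Real.sin θ := fun n => by
    rw [eq_div_iff hsin, Polynomial.Chebyshev.S_two_mul_real_cos]
  obtain ⟨q, hq | hq⟩ := Nat.even_or_odd' m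
  · have h0 : (Polynomial.Chebyshev.S ℝ (q - 1)).eval (2 * Real.cos θ) = 0 := by
      have : ((q : ℝ) - 1 + 1) * θ = Real.pi := by
        rw [hq] at hmθ
        push_cast at hmθ
        linarith
      rw [hS]
      push_cast
      rw [this, Real.sin_pi, zero_div]
    rw [show ((m : ℤ) - 2) / 2 = q - 1 by omega, show ((m : ℤ) - 1) / 2 = q - 1 by omega, h0]
    simp
  · have h0 : (Polynomial.Chebyshev.S ℝ q).eval (2 * Real.cos θ) +
        (Polynomial.Chebyshev.S ℝ (q - 1)).eval (2 * Real.cos θ) = 0 := by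
      have : ((q : ℝ) - 1 + 1) * θ = 2 * Real.pi - ((q : ℝ) + 1) * θ := by
        rw [hq] at hmθ
        push_cast at hmθ
        linarith
      rw [hS, hS]
      push_cast
      rw [this, Real.sin_two_pi_sub]
      ring
    rw [show ((m : ℤ) - 2) / 2 = q - 1 by omega, show ((m : ℤ) - 1) / 2 = q by omega,
      show ((m : ℤ) - 3) / 2 = q - 1 by omega, show (m : ℤ) / 2 = q by omega, h0]
    simp

variable (cs : CoxeterSystem M W)

/-- The geometric representation of a Coxeter group. -/
noncomputable def geomRep : W →* ((B →₀ ℝ) ≃ₗ[ℝ] (B →₀ ℝ)) :=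
  cs.lift ⟨_, isLiftable_reflection M⟩

theorem geomRep_simple (i : B) (v : B →₀ ℝ) :
    geomRep cs (cs.simple i) v = v - coroot M i v • Finsupp.single i 1 := by
  rw [geomRep, cs.lift_apply_simple (isLiftable_reflection M), reflection_apply]

theorem simple_injective : Function.Injective cs.simple := by
  intro i j hij
  by_contra h
  have := congrArg (fun w => geomRep cs w (Finsupp.single i 1) i) hij
  simp only [geomRep_simple, coroot_single, cartan_self] at this
  simp [Finsupp.single_eq_of_ne h] at this

/-- An element whose iterates under the geometric representation grow has infinite order. -/
theorem not_isOfFinOrder_of_growth (h : W) (p : (B →₀ ℝ) → Prop) (φ : (B →₀ ℝ) → ℝ)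
    (v : B →₀ ℝ) (hv : p v) (hp : ∀ v, p v → p (geomRep cs h v) ∧ φ v < φ (geomRep cs h v)) :
    ¬IsOfFinOrder h := by
  intro hfin
  obtain ⟨n, hn, hn1⟩ := isOfFinOrder_iff_pow_eq_one.1 hfin
  have key : ∀ n, p (geomRep cs (h ^ n) v) ∧ (0 < n → φ v < φ (geomRep cs (h ^ n) v)) := by
    intro n
    induction n with
    | zero => simpa using hv
    | succ n ih =>
      have := hp _ ih.1
      rw [pow_succ', map_mul, LinearEquiv.mul_apply]
      refine ⟨this.1, fun _ => ?_⟩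
      rcases Nat.eq_zero_or_pos n with rfl | hn
      · simpa using (hp v hv).2
      · exact (ih.2 hn).trans this.2
  have := (key n).2 hn
  simp [hn1] at this

/-- A triangle in the Coxeter diagram gives an element of infinite order. -/
theorem not_isOfFinOrder_triangle {a b c : B} (hab : a ≠ b) (hac : a ≠ c) (hbc : b ≠ c)
    (mab : M a b ≠ 2) (mac : M a c ≠ 2) (mbc : M b c ≠ 2) :
    ¬IsOfFinOrder (cs.simple c * cs.simple b * cs.simple a) := by
  have kab := one_le_cartan hab mab
  have kac := one_le_cartan hac mac
  have kbc := one_le_cartan hbc mbc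
  have kba := cartan_symm M b a
  have kca := cartan_symm M c a
  have kcb := cartan_symm M c b
  let V : ℝ → ℝ → ℝ → (B →₀ ℝ) := fun x y z =>
    x • Finsupp.single a 1 + y • Finsupp.single b 1 + z • Finsupp.single c 1
  have hVa : ∀ x y z, V x y z a = x := fun x y z => by
    simp [V, Finsupp.single_eq_of_ne hab, Finsupp.single_eq_of_ne hac]
  have sa : ∀ x y z, geomRep cs (cs.simple a) (V x y z) =
      V (-x + cartan M a b * y + cartan M a c * z) y z := fun x y z => by
    simp only [geomRep_simple, V, map_add, map_smul, coroot_single, cartan_self]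
    module
  have sb : ∀ x y z, geomRep cs (cs.simple b) (V x y z) =
      V x (-y + cartan M a b * x + cartan M b c * z) z := fun x y z => by
    simp only [geomRep_simple, V, map_add, map_smul, coroot_single, cartan_self, kba]
    module
  have sc : ∀ x y z, geomRep cs (cs.simple c) (V x y z) =
      V x y (-z + cartan M a c * x + cartan M b c * y) := fun x y z => by
    simp only [geomRep_simple, V, map_add, map_smul, coroot_single, cartan_self, kca, kcb]
    module
  refine not_isOfFinOrder_of_growth cs _
    (fun v => ∃ x y z, v = V x y z ∧ 0 ≤ x ∧ x + 1 ≤ y ∧ y + 1 ≤ z) (fun v => v a)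
    (V 0 1 2) ⟨0, 1, 2, rfl, by norm_num⟩ ?_
  rintro _ ⟨x, y, z, rfl, hx, hy, hz⟩
  rw [map_mul, map_mul, LinearEquiv.mul_apply, LinearEquiv.mul_apply, sa, sb, sc, hVa, hVa]
  generalize hx' : -x + cartan M a b * y + cartan M a c * z = x'
  generalize hy' : -y + cartan M a b * x' + cartan M b c * z = y'
  generalize hz' : -z + cartan M a c * x' + cartan M b c * y' = z'
  have h1 : z + 1 ≤ x' := by nlinarith
  have h2 : x' + 1 ≤ y' := by nlinarith
  have h3 : y' + 1 ≤ z' := by nlinarith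
  exact ⟨⟨x', y', z', rfl, by linarith, h2, h3⟩, by linarith⟩

/-- A vertex with four pairwise commuting neighbours in the Coxeter diagram gives an element of
infinite order. -/
theorem not_isOfFinOrder_star {c : B} {l : Fin 4 → B} (hc : ∀ i, c ≠ l i)
    (mc : ∀ i, M c (l i) ≠ 2) (ml : ∀ i j, i ≠ j → M (l i) (l j) = 2) :
    ¬IsOfFinOrder (cs.simple c * (cs.simple (l 0) * cs.simple (l 1) * cs.simple (l 2) *
      cs.simple (l 3))) := by
  let k : Fin 4 → ℝ := fun i => cartan M c (l i)
  have hk : ∀ i, 1 ≤ k i := fun i => one_le_cartan (hc i) (mc i)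
  have hkc : ∀ i, cartan M (l i) c = k i := fun i => cartan_symm M _ _
  have hkl : ∀ i j, i ≠ j → cartan M (l i) (l j) = 0 := fun i j hij => cartan_eq_zero (ml i j hij)
  let V : ℝ → (Fin 4 → ℝ) → (B →₀ ℝ) := fun x u =>
    x • Finsupp.single c 1 + ∑ i, (u i * k i) • Finsupp.single (l i) 1
  have hVc : ∀ x u, V x u c = x := fun x u => by
    simp [V, Fin.sum_univ_four, Finsupp.single_eq_of_ne (hc _)]
  have sc : ∀ x u, geomRep cs (cs.simple c) (V x u) = V (-x + ∑ i, u i * k i * k i) u :=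
    fun x u => by
      simp only [geomRep_simple, V, map_add, map_smul, coroot_single, cartan_self,
        Fin.sum_univ_four, k]
      module
  have sl : ∀ j x u, geomRep cs (cs.simple (l j)) (V x u) = V x (Function.update u j (x - u j)) :=
    fun j x u => by
      have : coroot M (l j) (V x u) = -(x * k j) + u j * k j * 2 := by
        simp only [V, map_add, map_sum, map_smul, coroot_single, smul_eq_mul, hkc]
        rw [Finset.sum_eq_single j (fun i _ hij => by rw [hkl j i hij.symm]; ring) (by simp),
          cartan_self]
        ring
      have hu : Function.update u j (x - u j) =
          fun i => u i + if i = j then x - 2 * u j else 0 := by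
        ext i
        rcases eq_or_ne i j with rfl | hij
        · simp only [Function.update_self, if_true]
          ring
        · simp [hij]
      rw [geomRep_simple, this, hu]
      simp only [V, add_mul, add_smul, Finset.sum_add_distrib, ite_mul, zero_mul, ite_smul,
        zero_smul, Finset.sum_ite_eq', Finset.mem_univ, if_true]
      module
  refine not_isOfFinOrder_of_growth cs _
    (fun v => ∃ x u, v = V x (fun _ => u) ∧ 0 ≤ u ∧ 2 * u + 1 ≤ x) (fun v => v c)
    (V 1 fun _ => 0) ⟨1, 0, rfl, by norm_num⟩ ?_
  rintro _ ⟨x, u, rfl, hu, hx⟩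
  simp only [map_mul, LinearEquiv.mul_apply, sl]
  have : Function.update (Function.update (Function.update (Function.update (fun _ : Fin 4 => u)
      3 (x - u)) 2 (x - u)) 1 (x - u)) 0 (x - u) = fun _ => x - u := by
    ext i
    fin_cases i <;> simp
  simp only [ne_eq, Fin.reduceEq, not_false_eq_true, Function.update_of_ne, this]
  rw [sc, hVc, hVc]
  have h4 : 4 * (x - u) ≤ ∑ i, (x - u) * k i * k i := by
    have : ∑ _i : Fin 4, (x - u) ≤ ∑ i, (x - u) * k i * k i := by
      refine Finset.sum_le_sum fun i _ => ?_
      nlinarith [mul_le_mul (hk i) (hk i) zero_le_one (by linarith [hk i]), hk i]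
    simpa only [Finset.sum_const, Finset.card_univ, Fintype.card_fin, nsmul_eq_mul,
      Nat.cast_ofNat] using this
  exact ⟨⟨_, _, rfl, by linarith, by linarith⟩, by linarith⟩

end Geometric

end CoxInf

namespace CoxInf

section Countability

variable {B : Type*} {W : Type*} [Group W] {M : CoxeterMatrix B} (cs : CoxeterSystem M W)

/-- If finitely generated standard parabolic subgroups are finite, then each vertex of the Coxeter
diagram has finitely many neighbours. -/
theorem finite_neighbours (hfin : ∀ J : Set B, J.Finite → (parabolic cs J : Set W).Finite) (c : B) :
    {b | c ≠ b ∧ M c b ≠ 2}.Finite := by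
  have hord : ∀ J : Set B, J.Finite → ∀ w ∈ parabolic cs J, IsOfFinOrder w := by
    intro J hJ w hw
    have : Finite (parabolic cs J) := hfin J hJ
    exact Submonoid.isOfFinOrder_coe.2 (isOfFinOrder_of_finite (⟨w, hw⟩ : parabolic cs J))
  by_contra hinf
  let f := Set.Infinite.natEmbedding _ hinf
  let l : Fin 4 → B := fun i => (f i : B)
  have hl : ∀ i j, i ≠ j → l i ≠ l j := fun i j hij h =>
    hij (Fin.ext (f.injective (Subtype.ext h)))
  have hcl : ∀ i, c ≠ l i ∧ M c (l i) ≠ 2 := fun i => (f i).2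
  have hmem : ∀ i, cs.simple (l i) ∈ parabolic cs (insert c (Set.range l)) := fun i =>
    simple_mem_parabolic cs (Or.inr ⟨i, rfl⟩)
  have hc : cs.simple c ∈ parabolic cs (insert c (Set.range l)) :=
    simple_mem_parabolic cs (Or.inl rfl)
  have hJ : (insert c (Set.range l)).Finite := (Set.finite_range l).insert c
  by_cases hcomm : ∀ i j, i ≠ j → M (l i) (l j) = 2
  · exact not_isOfFinOrder_star cs (fun i => (hcl i).1) (fun i => (hcl i).2) hcomm
      (hord _ hJ _ (mul_mem hc (mul_mem (mul_mem (mul_mem (hmem 0) (hmem 1)) (hmem 2)) (hmem 3))))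
  · push Not at hcomm
    obtain ⟨i, j, hij, hm⟩ := hcomm
    exact not_isOfFinOrder_triangle cs (hcl i).1 (hcl j).1 (hl i j hij) (hcl i).2 (hcl j).2 hm
      (hord _ hJ _ (mul_mem (mul_mem (hmem j) (hmem i)) hc))

/-- An irreducible Coxeter system whose finitely generated standard parabolic subgroups are finite
has countably many generators. -/
theorem countable_of_irreducible (hM : CoxIrreducible M)
    (hfin : ∀ J : Set B, J.Finite → (parabolic cs J : Set W).Finite) : Countable B := by
  obtain ⟨⟨b⟩, hconn⟩ := hM
  let X : ℕ → Set B := fun n => n.rec {b} fun _ Y => Y ∪ ⋃ c ∈ Y, {a | c ≠ a ∧ M c a ≠ 2}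
  have hX : ∀ n, X (n + 1) = X n ∪ ⋃ c ∈ X n, {a | c ≠ a ∧ M c a ≠ 2} := fun n => rfl
  have hXfin : ∀ n, (X n).Finite := by
    intro n
    induction n with
    | zero => exact Set.finite_singleton b
    | succ n ih => exact hX n ▸ ih.union (ih.biUnion fun c _ => finite_neighbours cs hfin c)
  have huniv : ⋃ n, X n = Set.univ := by
    refine (hconn (⋃ n, X n) ?_).resolve_left ?_
    · intro a ha c hc
      by_contra hm
      obtain ⟨n, hn⟩ := Set.mem_iUnion.1 ha
      refine hc (Set.mem_iUnion.2 ⟨n + 1, ?_⟩)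
      rw [hX]
      refine Or.inr (Set.mem_biUnion hn ⟨?_, hm⟩)
      rintro rfl
      exact hc ha
    · exact Set.Nonempty.ne_empty ⟨b, Set.mem_iUnion.2 ⟨0, rfl⟩⟩
  rw [← Set.countable_univ_iff, ← huniv]
  exact Set.countable_iUnion fun n => (hXfin n).countable

theorem countable_group (cs : CoxeterSystem M W) [Countable B] : Countable W :=
  cs.wordProd_surjective.countable

end Countability

end CoxInf

namespace CoxInf

/-! ### Decomposition of a Coxeter system along a partition of its diagram -/

section Decomposition

variable {B : Type*} {W : Type*} [Group W] {M : CoxeterMatrix B}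

/-- The restriction of a Coxeter matrix to a set of indices. -/
def restrictMatrix (M : CoxeterMatrix B) (p : Set B) : CoxeterMatrix p where
  M := fun i j => M i j
  isSymm := Matrix.IsSymm.ext fun i j => M.symmetric j i
  diagonal i := M.diagonal i
  off_diagonal i j h := M.off_diagonal i j (Subtype.coe_injective.ne h)

variable (cs : CoxeterSystem M W) {ι : Type*} (c : B → ι)

/-- The Coxeter matrix of the block `i` of a partition. -/
abbrev blockMatrix (M : CoxeterMatrix B) (c : B → ι) (i : ι) : CoxeterMatrix {b | c b = i} :=
  restrictMatrix M {b | c b = i}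

theorem isLiftable_blockInclusion (i : ι) :
    (blockMatrix M c i).IsLiftable fun b => cs.simple b.1 :=
  fun a b => cs.simple_mul_simple_pow a.1 b.1

/-- The inclusion of the Coxeter group of a block. -/
def blockInclusion (i : ι) : (blockMatrix M c i).Group →* W :=
  (blockMatrix M c i).toCoxeterSystem.lift ⟨_, isLiftable_blockInclusion cs c i⟩

theorem blockInclusion_simple (i : ι) (b : {b | c b = i}) :
    blockInclusion cs c i ((blockMatrix M c i).simple b) = cs.simple b.1 :=
  (blockMatrix M c i).toCoxeterSystem.lift_apply_simple (isLiftable_blockInclusion cs c i) b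

open Classical in
/-- The image of a generator in the Coxeter group of a block. -/
noncomputable def blockGenerator (M : CoxeterMatrix B) (c : B → ι) (i : ι) (b : B) :
    (blockMatrix M c i).Group :=
  if h : c b = i then (blockMatrix M c i).simple ⟨b, h⟩ else 1

variable {c}

theorem isLiftable_blockGenerator (hc : ∀ a b, c a ≠ c b → M a b = 2) (i : ι) :
    M.IsLiftable (blockGenerator M c i) := by
  intro a b
  have hsq := (blockMatrix M c i).toCoxeterSystem.simple_mul_simple_self
  simp only [CoxeterMatrix.toCoxeterSystem_simple] at hsq
  by_cases ha : c a = i <;> by_cases hb : c b = i <;>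
    simp only [blockGenerator, ha, hb, dif_pos, dif_neg, not_false_eq_true]
  · exact (blockMatrix M c i).toCoxeterSystem.simple_mul_simple_pow ⟨a, ha⟩ ⟨b, hb⟩
  · rw [hc a b (fun h => hb (h ▸ ha)), mul_one, pow_two, hsq]
  · rw [hc a b (fun h => ha (h.trans hb)), one_mul, pow_two, hsq]
  · rw [mul_one, one_pow]

variable (hc : ∀ a b, c a ≠ c b → M a b = 2)

/-- The projection to the Coxeter group of a block. -/
noncomputable def blockProjection (i : ι) : W →* (blockMatrix M c i).Group :=
  cs.lift ⟨_, isLiftable_blockGenerator hc i⟩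

theorem blockProjection_simple (i : ι) (b : B) :
    blockProjection cs hc i (cs.simple b) = blockGenerator M c i b :=
  cs.lift_apply_simple (isLiftable_blockGenerator hc i) b

theorem blockProjection_simple_of_ne {i : ι} {b : B} (h : c b ≠ i) :
    blockProjection cs hc i (cs.simple b) = 1 := by
  rw [blockProjection_simple, blockGenerator, dif_neg h]

theorem blockProjection_blockInclusion (i : ι) (g : (blockMatrix M c i).Group) :
    blockProjection cs hc i (blockInclusion cs c i g) = g := by
  suffices (blockProjection cs hc i).comp (blockInclusion cs c i) = MonoidHom.id _ from
    DFunLike.congr_fun this g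
  refine (blockMatrix M c i).toCoxeterSystem.ext_simple fun b => ?_
  rw [CoxeterMatrix.toCoxeterSystem_simple, MonoidHom.comp_apply, blockInclusion_simple,
    blockProjection_simple, blockGenerator]
  exact dif_pos b.2

theorem blockProjection_blockInclusion_of_ne {i k : ι} (hik : i ≠ k)
    (g : (blockMatrix M c i).Group) :
    blockProjection cs hc k (blockInclusion cs c i g) = 1 := by
  suffices (blockProjection cs hc k).comp (blockInclusion cs c i) = 1 from
    DFunLike.congr_fun this g
  refine (blockMatrix M c i).toCoxeterSystem.ext_simple fun b => ?_
  rw [CoxeterMatrix.toCoxeterSystem_simple, MonoidHom.comp_apply, blockInclusion_simple]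
  exact blockProjection_simple_of_ne cs hc (fun h => hik (b.2.symm.trans h))

theorem commute_simple_of_eq_two {a b : B} (h : M a b = 2) :
    Commute (cs.simple a) (cs.simple b) := by
  have := cs.simple_mul_simple_pow a b
  rw [h, pow_two] at this
  have := eq_inv_of_mul_eq_one_left this
  rwa [mul_inv_rev, cs.inv_simple, cs.inv_simple] at this

theorem commute_simple_blockInclusion (hc : ∀ a b, c a ≠ c b → M a b = 2) {b : B} {i : ι}
    (hb : c b ≠ i) (g : (blockMatrix M c i).Group) :
    Commute (cs.simple b) (blockInclusion cs c i g) := by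
  refine (blockMatrix M c i).toCoxeterSystem.simple_induction_left
    (p := fun g => Commute (cs.simple b) (blockInclusion cs c i g)) g ?_ ?_
  · rw [map_one]
    exact Commute.one_right _
  · intro g a h
    rw [CoxeterMatrix.toCoxeterSystem_simple, map_mul, blockInclusion_simple]
    refine (commute_simple_of_eq_two cs (hc _ _ fun h => hb ?_)).mul_right h
    exact h.trans a.2

theorem exists_eq_blockInclusion_mul (hc : ∀ a b, c a ≠ c b → M a b = 2) (F : Set ι) (i : ι)
    {w : W} (hw : w ∈ parabolic cs (c ⁻¹' insert i F)) :
    ∃ g, ∃ u ∈ parabolic cs (c ⁻¹' F), w = blockInclusion cs c i g * u := by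
  refine parabolic_induction cs
    (p := fun w => ∃ g, ∃ u ∈ parabolic cs (c ⁻¹' F), w = blockInclusion cs c i g * u) ?_ ?_ hw
  · exact ⟨1, 1, one_mem _, by simp⟩
  · rintro b hb _ ⟨g, u, hu, rfl⟩
    by_cases hbi : c b = i
    · refine ⟨(blockMatrix M c i).simple ⟨b, hbi⟩ * g, u, hu, ?_⟩
      rw [map_mul, blockInclusion_simple, mul_assoc]
    · refine ⟨g, cs.simple b * u,
        mul_mem (simple_mem_parabolic cs (hb.resolve_left hbi)) hu, ?_⟩
      rw [← mul_assoc, (commute_simple_blockInclusion cs hc hbi g).eq, mul_assoc]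

theorem eq_one_of_blockProjection (w : W) (hw : ∀ i, blockProjection cs hc i w = 1) : w = 1 := by
  obtain ⟨F, hF, hwF⟩ : ∃ F : Set ι, F.Finite ∧ w ∈ parabolic cs (c ⁻¹' F) := by
    refine cs.simple_induction_left
      (p := fun w => ∃ F : Set ι, F.Finite ∧ w ∈ parabolic cs (c ⁻¹' F)) w
      ⟨∅, Set.finite_empty, one_mem _⟩ ?_
    rintro w b ⟨F, hF, hw⟩
    exact ⟨insert (c b) F, hF.insert _, mul_mem (simple_mem_parabolic cs (Set.mem_insert _ _))
      (parabolic_mono cs (Set.preimage_mono (Set.subset_insert _ _)) hw)⟩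
  induction F, hF using Set.Finite.induction_on generalizing w with
  | empty => simpa [parabolic] using hwF
  | @insert i F hi _ ih =>
    obtain ⟨g, u, hu, rfl⟩ := exists_eq_blockInclusion_mul cs hc F i hwF
    have hui : blockProjection cs hc i u = 1 := by
      refine parabolic_induction cs (p := fun u => blockProjection cs hc i u = 1) (map_one _) ?_ hu
      intro b hb u hu
      rw [map_mul, hu, mul_one]
      exact blockProjection_simple_of_ne cs hc (fun h => hi (h ▸ hb))
    have hg := hw i
    rw [map_mul, blockProjection_blockInclusion, hui, mul_one] at hg
    rw [hg, map_one, one_mul] at hw ⊢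
    exact ih u hw hu

theorem blockProjection_mem_weakProduct (w : W) :
    MonoidHom.pi (blockProjection cs hc) w ∈
      weakProduct ι fun i => (blockMatrix M c i).Group := by
  refine cs.simple_induction (p := fun w => MonoidHom.pi (blockProjection cs hc) w ∈
    weakProduct ι fun i => (blockMatrix M c i).Group) w (fun b => ?_) ?_ fun w w' hw hw' => ?_
  · refine (Set.finite_singleton (c b)).subset fun i hi => ?_
    by_contra h
    exact hi (blockProjection_simple_of_ne cs hc fun h' => h h'.symm)
  · rw [map_one]
    exact one_mem _
  · rw [map_mul]
    exact mul_mem hw hw'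

theorem exists_blockProjection_eq (f : ∀ i, (blockMatrix M c i).Group)
    (hf : {i | f i ≠ 1}.Finite) : ∃ w, ∀ i, blockProjection cs hc i w = f i := by
  classical
  obtain ⟨F, hF, hfF⟩ : ∃ F : Set ι, F.Finite ∧ ∀ i ∉ F, f i = 1 :=
    ⟨_, hf, fun i hi => by simpa using hi⟩
  clear hf
  induction F, hF using Set.Finite.induction_on generalizing f with
  | empty => exact ⟨1, fun i => by rw [map_one, hfF i (Set.notMem_empty i)]⟩
  | @insert i F hi _ ih =>
    obtain ⟨w, hw⟩ := ih (Function.update f i 1) fun k hk => by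
      rcases eq_or_ne k i with rfl | hki
      · exact Function.update_self ..
      · rw [Function.update_of_ne hki]
        exact hfF k fun h => h.elim hki hk
    refine ⟨blockInclusion cs c i (f i) * w, fun k => ?_⟩
    rw [map_mul, hw]
    rcases eq_or_ne k i with rfl | hki
    · rw [blockProjection_blockInclusion, Function.update_self, mul_one]
    · rw [blockProjection_blockInclusion_of_ne cs hc hki.symm, Function.update_of_ne hki, one_mul]

/-- A Coxeter group is the weak direct product of the Coxeter groups of pairwise orthogonal
blocks. -/
noncomputable def weakProductEquiv :
    W ≃* weakProduct ι fun i => (blockMatrix M c i).Group :=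
  MulEquiv.ofBijective
    ((MonoidHom.pi (blockProjection cs hc)).codRestrict _ (blockProjection_mem_weakProduct cs hc))
    ⟨(injective_iff_map_eq_one _).2 fun w hw => eq_one_of_blockProjection cs hc w fun i =>
        congrFun (congrArg Subtype.val hw) i,
      fun f => (exists_blockProjection_eq cs hc f.1 f.2).imp fun _ hw => Subtype.ext (funext hw)⟩

theorem block_finite_or_isLocallyFinite (hc : ∀ a b, c a ≠ c b → M a b = 2)
    (hfin : ∀ J : Set B, (cs.simple '' J).Finite → (parabolic cs J : Set W).Finite) (i : ι) :
    Finite (blockMatrix M c i).Group ∨ IsLocallyFinite (blockMatrix M c i) := by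
  rcases finite_or_infinite (blockMatrix M c i).Group with h | h
  · exact Or.inl h
  refine Or.inr ⟨h, fun J hJ => ?_⟩
  have hinj : Function.Injective (blockInclusion cs c i) :=
    Function.LeftInverse.injective (blockProjection_blockInclusion cs hc i)
  refine ((hfin (Subtype.val '' J) ((hJ.image _).image _)).preimage hinj.injOn).subset ?_
  change Subgroup.closure _ ≤ (parabolic cs (Subtype.val '' J)).comap (blockInclusion cs c i)
  rw [Subgroup.closure_le]
  rintro _ ⟨b, hb, rfl⟩
  rw [SetLike.mem_coe, Subgroup.mem_comap, blockInclusion_simple]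
  exact simple_mem_parabolic cs ⟨b, hb, rfl⟩

end Decomposition

section Components

variable {B : Type*} (M : CoxeterMatrix B)

/-- The connected components of the Coxeter diagram. -/
def Component : Type _ := Quotient (Relation.EqvGen.setoid fun a b => M a b ≠ 2)

/-- The connected component of a vertex of the Coxeter diagram. -/
def component (b : B) : Component M := Quotient.mk _ b

theorem component_surjective : Function.Surjective (component M) := Quotient.mk_surjective

theorem component_eq_iff {a b : B} :
    component M a = component M b ↔ Relation.EqvGen (fun a b => M a b ≠ 2) a b :=
  Quotient.eq

theorem eq_two_of_component_ne (a b : B) (h : component M a ≠ component M b) : M a b = 2 := by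
  by_contra hm
  exact h ((component_eq_iff M).2 (.rel _ _ hm))

theorem irreducible_component (i : Component M) :
    CoxIrreducible (blockMatrix M (component M) i) := by
  obtain ⟨b, rfl⟩ := component_surjective M i
  refine ⟨⟨⟨b, rfl⟩⟩, fun X hX => or_iff_not_imp_left.2 fun hne => ?_⟩
  have key : ∀ x y, Relation.EqvGen (fun a b => M a b ≠ 2) x y →
      (x ∈ Subtype.val '' X ↔ y ∈ Subtype.val '' X) := by
    have aux : ∀ x y, M x y ≠ 2 → x ∈ Subtype.val '' X → y ∈ Subtype.val '' X := by
      rintro _ y hxy ⟨x, hx, rfl⟩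
      by_contra hy
      have hyc : component M y = component M b :=
        ((component_eq_iff M).2 (.rel _ _ hxy)).symm.trans x.2
      exact hxy (hX x hx ⟨y, hyc⟩ fun h => hy ⟨_, h, rfl⟩)
    intro x y h
    induction h with
    | rel x y h => exact ⟨aux x y h, aux y x (by rwa [M.symmetric])⟩
    | refl x => exact Iff.rfl
    | symm x y _ ih => exact ih.symm
    | trans x y z _ _ ih ih' => exact ih.trans ih'
  obtain ⟨x, hx⟩ := Set.nonempty_iff_ne_empty.2 hne
  refine Set.eq_univ_of_forall fun y => ?_
  obtain ⟨y', hy', h⟩ := (key x y ((component_eq_iff M).1 (x.2.trans y.2.symm))).1 ⟨x, hx, rfl⟩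
  exact Subtype.coe_injective h ▸ hy'

end Components

end CoxInf

namespace CoxInf

section LocallyFinite

/-- Every finite subset of the group generates a finite subgroup. -/
def FiniteClosures (G : Type*) [Group G] : Prop :=
  ∀ s : Set G, s.Finite → (Subgroup.closure s : Set G).Finite

theorem FiniteClosures.of_injective {G H : Type*} [Group G] [Group H] (h : FiniteClosures H)
    (φ : G →* H) (hφ : Function.Injective φ) : FiniteClosures G := by
  refine fun s hs => ((h (φ '' s) (hs.image φ)).preimage hφ.injOn).subset ?_
  change Subgroup.closure s ≤ (Subgroup.closure (φ '' s)).comap φ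
  rw [Subgroup.closure_le]
  exact fun x hx => Subgroup.subset_closure ⟨x, hx, rfl⟩

theorem IsLocallyFinite.finite_parabolic {B : Type*} {M : CoxeterMatrix B} (h : IsLocallyFinite M)
    (J : Set B) (hJ : J.Finite) : (parabolic M.toCoxeterSystem J : Set M.Group).Finite := by
  rw [parabolic, CoxeterMatrix.toCoxeterSystem_simple]
  have := h.2 J hJ
  exact Set.toFinite (Subgroup.closure (M.simple '' J) : Set M.Group)

theorem exists_finite_subset_parabolic {B W : Type*} [Group W] {M : CoxeterMatrix B}
    (cs : CoxeterSystem M W) {s : Set W} (hs : s.Finite) :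
    ∃ J : Set B, J.Finite ∧ s ⊆ parabolic cs J := by
  have h1 : ∀ w : W, ∃ J : Set B, J.Finite ∧ w ∈ parabolic cs J := fun w => by
    refine cs.simple_induction_left (p := fun w => ∃ J : Set B, J.Finite ∧ w ∈ parabolic cs J) w
      ⟨∅, Set.finite_empty, one_mem _⟩ ?_
    rintro w b ⟨J, hJ, hw⟩
    exact ⟨insert b J, hJ.insert b, mul_mem (simple_mem_parabolic cs (Set.mem_insert _ _))
      (parabolic_mono cs (Set.subset_insert _ _) hw)⟩
  choose J hJ hw using h1
  exact ⟨⋃ w ∈ s, J w, hs.biUnion fun w _ => hJ w, fun w hws =>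
    parabolic_mono cs (Set.subset_biUnion_of_mem (u := J) hws) (hw w)⟩

theorem finiteClosures_of_finite_or_isLocallyFinite {B : Type*} {M : CoxeterMatrix B}
    (h : Finite M.Group ∨ IsLocallyFinite M) : FiniteClosures M.Group := by
  rcases h with h | h
  · exact fun s _ => Set.toFinite _
  · intro s hs
    obtain ⟨J, hJ, hsJ⟩ := exists_finite_subset_parabolic M.toCoxeterSystem hs
    exact (h.finite_parabolic J hJ).subset ((Subgroup.closure_le _).2 hsJ)

theorem countable_of_finite_or_isLocallyFinite {B : Type*} {M : CoxeterMatrix B}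
    (hM : CoxIrreducible M) (h : Finite M.Group ∨ IsLocallyFinite M) : Countable M.Group := by
  rcases h with h | h
  · exact Finite.to_countable
  · have := countable_of_irreducible M.toCoxeterSystem hM h.finite_parabolic
    exact countable_group M.toCoxeterSystem

variable {ι : Type*} {G : ι → Type*} [∀ i, Group (G i)]

theorem countable_weakProduct [Countable ι] [∀ i, Countable (G i)] :
    Countable (weakProduct ι G) := by
  classical
  let φ : weakProduct ι G → Finset (Σ i, G i) := fun f =>
    (show {i | f.1 i ≠ 1}.Finite from f.2).toFinset.image fun i => ⟨i, f.1 i⟩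
  have hφ : ∀ f i x, (⟨i, x⟩ : Σ i, G i) ∈ φ f ↔ f.1 i ≠ 1 ∧ f.1 i = x := by
    intro f i x
    simp only [φ, Finset.mem_image, Set.Finite.mem_toFinset, Set.mem_ofPred_eq]
    constructor
    · rintro ⟨j, hj, h⟩
      cases h
      exact ⟨hj, rfl⟩
    · rintro ⟨h, rfl⟩
      exact ⟨i, h, rfl⟩
  refine Function.Injective.countable (f := φ) fun f g hfg => Subtype.ext (funext fun i => ?_)
  by_cases hf : f.1 i = 1
  · by_contra hg
    have := (hφ g i (g.1 i)).2 ⟨fun h => hg (hf.trans h.symm), rfl⟩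
    rw [← hfg, hφ] at this
    exact this.1 hf
  · have := (hφ f i (f.1 i)).2 ⟨hf, rfl⟩
    rw [hfg, hφ] at this
    exact this.2.symm

theorem FiniteClosures.weakProduct (h : ∀ i, FiniteClosures (G i)) :
    FiniteClosures (weakProduct ι G) := by
  intro s hs
  let ev : ∀ i, CoxInf.weakProduct ι G →* G i := fun i =>
    (Pi.evalMonoidHom G i).comp (Subgroup.subtype _)
  have hF : (⋃ f ∈ s, {i | f.1 i ≠ 1}).Finite := hs.biUnion fun f _ => f.2
  set F := ⋃ f ∈ s, {i | f.1 i ≠ 1}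
  have hmem : ∀ i, ∀ f ∈ Subgroup.closure s, f.1 i ∈ Subgroup.closure (ev i '' s) := by
    intro i f hf
    have : Subgroup.closure s ≤ (Subgroup.closure (ev i '' s)).comap (ev i) := by
      rw [Subgroup.closure_le]
      exact fun x hx => Subgroup.subset_closure ⟨x, hx, rfl⟩
    exact this hf
  have hone : ∀ i ∉ F, ∀ f ∈ Subgroup.closure s, f.1 i = 1 := by
    intro i hi f hf
    have : Subgroup.closure (ev i '' s) ≤ ⊥ := by
      rw [Subgroup.closure_le]
      rintro _ ⟨f, hf, rfl⟩
      by_contra h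
      exact hi (Set.mem_biUnion hf h)
    exact this (hmem i f hf)
  have := hF.to_subtype
  have hpi : (Set.univ.pi fun i : F => (Subgroup.closure (ev i '' s) : Set (G i))).Finite :=
    Set.Finite.pi fun i => h i _ (hs.image _)
  refine Set.Finite.of_injOn (f := fun f (i : F) => f.1 i.1) ?_ ?_ hpi
  · exact fun f hf i _ => hmem i f hf
  · intro f hf g hg hfg
    refine Subtype.ext (funext fun i => ?_)
    by_cases hi : i ∈ F
    · exact congrFun hfg ⟨i, hi⟩
    · rw [hone i hi f hf, hone i hi g hg]

end LocallyFinite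

end CoxInf

open CoxInf in
/-- For an infinite Coxeter system `(W,S)`, the poset `W̄` under the weak order is a
complete lattice if and only if `W` is isomorphic to a weak direct product of countably
many irreducible Coxeter groups, each of which is finite or locally finite. -/
theorem wbar_complete_lattice_iff_weak_product
    {B : Type*} {W : Type*} [Group W] {M : CoxeterMatrix B}
    (cs : CoxeterSystem M W) (hW : Infinite W) :
    (∀ A : Set (W ⊕ {ω : ℕ → B // IsInfRedExpr cs ω}),
      (∃ v, (∀ a ∈ A, barInv cs a ⊆ barInv cs v) ∧
        ∀ u, (∀ a ∈ A, barInv cs a ⊆ barInv cs u) → barInv cs v ⊆ barInv cs u) ∧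
      (∃ v, (∀ a ∈ A, barInv cs v ⊆ barInv cs a) ∧
        ∀ u, (∀ a ∈ A, barInv cs u ⊆ barInv cs a) → barInv cs u ⊆ barInv cs v)) ↔
    ∃ (ι : Type) (_ : Countable ι) (B' : ι → Type) (M' : ∀ i, CoxeterMatrix (B' i)),
      (∀ i, CoxIrreducible (M' i)) ∧
      (∀ i, Finite (M' i).Group ∨ IsLocallyFinite (M' i)) ∧
      Nonempty (W ≃* weakProduct ι (fun i => (M' i).Group)) := by
  constructor
  · intro h
    obtain ⟨v, hv, -⟩ := (h Set.univ).1
    have hv : ∀ a, barInv cs a ⊆ barInv cs v := fun a => hv a (Set.mem_univ a)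
    have := countable_of_bar_top cs hv
    have : Countable B := (simple_injective cs).countable
    let e := equivShrink.{0} B
    let cs' := cs.reindex e
    have hfin : ∀ J, (cs'.simple '' J).Finite → (parabolic cs' J : Set W).Finite := by
      intro J hJ
      have him : cs'.simple '' J = cs.simple '' (e.symm '' J) := by
        rw [Set.image_image]
        rfl
      rw [him] at hJ
      rw [parabolic, him]
      exact finite_parabolic_of_bar_top cs hv hJ
    have := e.symm.injective.countable
    have := (component_surjective (M.reindex e)).countable
    exact ⟨Component (M.reindex e), this, _, blockMatrix (M.reindex e) (component (M.reindex e)),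
      irreducible_component _,
      block_finite_or_isLocallyFinite cs' (eq_two_of_component_ne _) hfin,
      ⟨weakProductEquiv cs' (eq_two_of_component_ne _)⟩⟩
  · rintro ⟨ι, _, B', M', hirr, hM', ⟨e⟩⟩
    have := fun i => countable_of_finite_or_isLocallyFinite (hirr i) (hM' i)
    have := countable_weakProduct (ι := ι) (G := fun i => (M' i).Group)
    have : Countable W := e.injective.countable
    have hW' : FiniteClosures W :=
      (FiniteClosures.weakProduct fun i => finiteClosures_of_finite_or_isLocallyFinite
        (hM' i)).of_injective e.toMonoidHom e.injective
    have hjoin := exists_bar_join cs fun J hJ => hW' _ hJ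
    refine fun A => ⟨hjoin A, ?_⟩
    obtain ⟨v, hv, hmin⟩ := hjoin {u | ∀ a ∈ A, barInv cs u ⊆ barInv cs a}
    exact ⟨v, fun a ha => hmin a fun u hu => hu a ha, fun u hu => hv u hu⟩
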